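/- arXiv:2001.04546 — 2 statements merged into one kernel-verified Lean document; each statement's English description precedes it below -/
import Mathlib

section
/- Let β ∈ (0,1) and b ≥ 0. Then the function g : [0,∞) → ℝ defined by g(x) = (x^{1-β} + b)^{1/(1-β)} is concave on [0,∞). -/
open Real Set

/-- for `β ∈ (0,1)` and `b ≥ 0`, the function
`g(x) = (x^(1-β) + b)^(1/(1-β))` is concave on `[0,∞)`. -/
theorem stmt_4 (β b : ℝ) (hβ : β ∈ Set.Ioo (0:ℝ) 1) (hb : 0 ≤ b) :
    ConcaveOn ℝ (Set.Ici (0:ℝ))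
      (fun x : ℝ => (x ^ (1 - β) + b) ^ (1 / (1 - β))) := by
  obtain ⟨hβ0, hβ1⟩ := hβ
  have hα : 0 < 1 - β := by linarith
  have hα1 : 1 - β ≤ 1 := by linarith
  generalize 1 - β = α at hα hα1 ⊢
  have hq : 1 ≤ 1 / α := by rwa [le_div_iff₀ hα, one_mul]
  have hcancel : ∀ u : ℝ, 0 ≤ u → (u ^ α) ^ (1 / α) = u := fun u hu => by
    rw [one_div, rpow_rpow_inv hu hα.ne']
  have hcancel' : ∀ u : ℝ, 0 ≤ u → (u ^ (1 / α)) ^ α = u := fun u hu => by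
    rw [one_div, rpow_inv_rpow hu hα.ne']
  refine ⟨convex_Ici 0, fun x hx y hy s t hs ht hst => ?_⟩
  simp only [mem_Ici] at hx hy
  simp only [smul_eq_mul]
  -- Minkowski's inequality in `ℓ^(1/α)` for the vectors `((s x)^α, (t y)^α)` and `(s^α b, t^α b)`
  have minkowski := Real.Lp_add_le_of_nonneg (Finset.univ : Finset (Fin 2))
    (f := ![(s * x) ^ α, (t * y) ^ α]) (g := ![s ^ α * b, t ^ α * b]) hq
    (fun i _ => by fin_cases i <;> simp <;> positivity)
    (fun i _ => by fin_cases i <;> simp <;> positivity)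
  simp only [Fin.sum_univ_two, Matrix.cons_val_zero, Matrix.cons_val_one, one_div_one_div]
    at minkowski
  have hscale : ∀ r z : ℝ, 0 ≤ r → 0 ≤ z →
      ((r * z) ^ α + r ^ α * b) ^ (1 / α) = r * (z ^ α + b) ^ (1 / α) := fun r z hr hz => by
    rw [mul_rpow hr hz, ← mul_add, mul_rpow (by positivity) (by positivity), hcancel r hr]
  rw [hscale s x hs hx, hscale t y ht hy, hcancel _ (by positivity), hcancel _ (by positivity),
    mul_rpow (by positivity) hb, mul_rpow (by positivity) hb, hcancel s hs, hcancel t ht,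
    ← add_mul, hst, one_mul, hcancel' b hb] at minkowski
  have h := rpow_le_rpow (by positivity) minkowski (by positivity : 0 ≤ 1 / α)
  rwa [hcancel _ (by positivity)] at h
end

section
/- Let c > 0, β ∈ (0,1), m > 0, ℓ > 0, and let f : [0,∞) → [0,∞) be continuous with f(z) ≤ c·z^β for all z ≥ 0. If w : [0,ℓ] → ℝ is continuous, nonnegative, and satisfies w(t) = ∫_t^ℓ f(w(s)) ds + m for all t ∈ [0,ℓ], then w(t) ≤ (m^{1-β} + c(1-β)(ℓ-t))^{1/(1-β)} for every t ∈ [0,ℓ]. -/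
open Real Set

/-- A solution of the backward integral equation `w t = ∫ s in t..ℓ, g s + m` with continuous `g`
satisfies `w' = -g` in the interior. -/
theorem hasDerivAt_of_backward_integral_eq {ℓ m t : ℝ} {g w : ℝ → ℝ}
    (hg : ContinuousOn g (Icc 0 ℓ)) (hw : ∀ t ∈ Icc (0 : ℝ) ℓ, w t = (∫ s in t..ℓ, g s) + m)
    (ht : t ∈ Ioo 0 ℓ) : HasDerivAt w (-g t) t := by
  have hint : IntervalIntegrable g MeasureTheory.volume t ℓ := by
    apply ContinuousOn.intervalIntegrable
    rw [uIcc_of_le ht.2.le]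
    exact hg.mono (Icc_subset_Icc_left ht.1.le)
  have hmeas : StronglyMeasurableAtFilter g (nhds t) MeasureTheory.volume :=
    (hg.mono Ioo_subset_Icc_self).stronglyMeasurableAtFilter isOpen_Ioo t ht
  have hcont : ContinuousAt g t := hg.continuousAt (Icc_mem_nhds ht.1 ht.2)
  refine ((intervalIntegral.integral_hasDerivAt_left hint hmeas hcont).add_const m)
    |>.congr_of_eventuallyEq ?_
  filter_upwards [Icc_mem_nhds ht.1 ht.2] with s hs using hw s hs

/-- comparison principle: if `f(z) ≤ c·z^β` and `w` solves the
backward integral equation with kernel `f`, then `w` is dominated by the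
explicit solution for the kernel `c·z^β`. -/
theorem stmt_18 (c β m ℓ : ℝ) (hc : 0 < c) (hβ : β ∈ Set.Ioo (0:ℝ) 1)
    (hm : 0 < m) (hℓ : 0 < ℓ)
    (f : ℝ → ℝ) (hf_cont : ContinuousOn f (Set.Ici 0))
    (hf_nonneg : ∀ z ≥ (0:ℝ), 0 ≤ f z)
    (hf_le : ∀ z ≥ (0:ℝ), f z ≤ c * z ^ β)
    (w : ℝ → ℝ) (hw_cont : ContinuousOn w (Set.Icc 0 ℓ))
    (hw_nonneg : ∀ t ∈ Set.Icc (0:ℝ) ℓ, 0 ≤ w t)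
    (hw : ∀ t ∈ Set.Icc (0:ℝ) ℓ, w t = (∫ s in t..ℓ, f (w s)) + m) :
    ∀ t ∈ Set.Icc (0:ℝ) ℓ,
      w t ≤ (m ^ (1 - β) + c * (1 - β) * (ℓ - t)) ^ (1 / (1 - β)) := by
  have hw_ge : ∀ t ∈ Icc (0 : ℝ) ℓ, m ≤ w t := by
    intro t ht
    rw [hw t ht]
    have : 0 ≤ ∫ s in t..ℓ, f (w s) :=
      intervalIntegral.integral_nonneg ht.2 fun s hs =>
        hf_nonneg _ (hw_nonneg s ⟨ht.1.trans hs.1, hs.2⟩)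
    linarith
  have hw_pos : ∀ t ∈ Icc (0 : ℝ) ℓ, 0 < w t := fun t ht => hm.trans_le (hw_ge t ht)
  have hβ' : 0 < 1 - β := sub_pos.2 hβ.2
  have hderiv : ∀ t ∈ Ioo 0 ℓ, HasDerivAt (fun t => w t ^ (1 - β) + c * (1 - β) * t)
      (-f (w t) * (1 - β) * w t ^ (1 - β - 1) + c * (1 - β) * 1) t := fun t ht =>
    ((hasDerivAt_of_backward_integral_eq (hf_cont.comp hw_cont hw_nonneg) hw ht).rpow_const
      (Or.inl (hw_pos t (Ioo_subset_Icc_self ht)).ne')).add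
      ((hasDerivAt_id t).const_mul (c * (1 - β)))
  have hmono : MonotoneOn (fun t => w t ^ (1 - β) + c * (1 - β) * t) (Icc 0 ℓ) := by
    refine monotoneOn_of_deriv_nonneg (convex_Icc 0 ℓ) ?_ ?_ ?_
    · exact (hw_cont.rpow_const fun t ht => Or.inl (hw_pos t ht).ne').add (by fun_prop)
    · rw [interior_Icc]
      exact fun t ht => (hderiv t ht).differentiableAt.differentiableWithinAt
    · rw [interior_Icc]
      intro t ht
      have hpos := hw_pos t (Ioo_subset_Icc_self ht)
      rw [(hderiv t ht).deriv, show 1 - β - 1 = -β by ring]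
      have hle : f (w t) * w t ^ (-β) ≤ c := by
        rw [rpow_neg hpos.le, ← div_eq_mul_inv, div_le_iff₀ (rpow_pos_of_pos hpos β)]
        exact hf_le _ hpos.le
      nlinarith
  have hw_end : w ℓ = m := by simpa using hw ℓ (right_mem_Icc.2 hℓ.le)
  intro t ht
  have hle := hmono ht (right_mem_Icc.2 hℓ.le) ht.2
  simp only [hw_end] at hle
  rw [one_div, ← rpow_rpow_inv (hw_pos t ht).le hβ'.ne']
  refine rpow_le_rpow (rpow_nonneg (hw_pos t ht).le _) ?_ (inv_nonneg.2 hβ'.le)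
  linarith
end
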